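/- Let A ∈ ℝ^{n×n} and let A·U = U·T + u·bᵀ be a randomized Krylov–Schur factorization of order k, where (U u) ∈ ℝ^{n×(k+1)} is sketch-orthonormal with respect to Ω ∈ ℝ^{d×n}, and Ω is an ε-embedding (0 ≤ ε < 1) for the column span of (U u). Let (λ, y) be an eigenpair of T with ‖y‖ = 1 and set x := U·y. Then x ≠ 0 and √((1−ε)/(1+ε))·|bᵀy| ≤ ‖A·x − λ·x‖ / ‖x‖ ≤ √((1+ε)/(1−ε))·|bᵀy|. -/

import Mathlib

open Matrix

/-- Euclidean (ℓ²) norm of a vector in `Fin n → ℝ`. -/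
noncomputable def eNorm {n : ℕ} (x : Fin n → ℝ) : ℝ :=
  ‖(WithLp.equiv 2 (Fin n → ℝ)).symm x‖

/-- `Ω` is an ε-embedding for the set `K ⊆ ℝⁿ`. -/
def IsEpsEmbedding {d n : ℕ} (Ω : Matrix (Fin d) (Fin n) ℝ) (ε : ℝ)
    (K : Set (Fin n → ℝ)) : Prop :=
  ∀ x ∈ K, (1 - ε) * eNorm x ^ 2 ≤ eNorm (Ω.mulVec x) ^ 2 ∧
    eNorm (Ω.mulVec x) ^ 2 ≤ (1 + ε) * eNorm x ^ 2

/-- `M` is sketch-orthonormal w.r.t. `Ω` if `(ΩM)ᵀ(ΩM) = I`. -/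
def SketchOrthonormal {d n : ℕ} {m : Type*} [Fintype m] [DecidableEq m]
    (Ω : Matrix (Fin d) (Fin n) ℝ) (M : Matrix (Fin n) m ℝ) : Prop :=
  (Ω * M)ᵀ * (Ω * M) = 1

theorem eNorm_sq_dot {n : ℕ} (x : Fin n → ℝ) : eNorm x ^ 2 = x ⬝ᵥ x := by
  rw [eNorm, EuclideanSpace.norm_sq_eq]
  simp [dotProduct, sq]

theorem eNorm_nonneg' {n : ℕ} (x : Fin n → ℝ) : 0 ≤ eNorm x := norm_nonneg _

theorem sketch_norm {d n : ℕ} {m : Type*} [Fintype m] [DecidableEq m]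
    (Ω : Matrix (Fin d) (Fin n) ℝ) (M : Matrix (Fin n) m ℝ)
    (h : SketchOrthonormal Ω M) (w : m → ℝ) :
    eNorm (Ω.mulVec (M.mulVec w)) ^ 2 = w ⬝ᵥ w := by
  unfold SketchOrthonormal at h
  rw [eNorm_sq_dot, mulVec_mulVec, dotProduct_mulVec, vecMul_mulVec, ← mulVec_transpose]
  rw [transpose_mul, transpose_transpose, h, one_mulVec]

theorem le_of_sq_le_sq_aux {a b : ℝ} (hb : 0 ≤ b) (h : a ^ 2 ≤ b ^ 2) : a ≤ b :=
  abs_le_of_sq_le_sq' h hb |>.2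

theorem stmt_15 {n k d : ℕ} (ε : ℝ) (hε0 : 0 ≤ ε) (hε1 : ε < 1)
    (A : Matrix (Fin n) (Fin n) ℝ) (U : Matrix (Fin n) (Fin k) ℝ)
    (u : Fin n → ℝ) (b : Fin k → ℝ) (T : Matrix (Fin k) (Fin k) ℝ)
    (Ω : Matrix (Fin d) (Fin n) ℝ)
    (hdec : A * U = U * T + vecMulVec u b)
    (hT : ∀ i j : Fin k, (j : ℕ) + 1 < (i : ℕ) → T i j = 0)
    (horth : SketchOrthonormal Ω (fromCols U (replicateCol (Fin 1) u)))
    (hemb : IsEpsEmbedding Ω ε (Set.range (fromCols U (replicateCol (Fin 1) u)).mulVec))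
    (lam : ℝ) (y : Fin k → ℝ) (heig : T.mulVec y = lam • y) (hy : eNorm y = 1)
    (x : Fin n → ℝ) (hx : x = U.mulVec y) :
    x ≠ 0 ∧
      Real.sqrt ((1 - ε) / (1 + ε)) * |b ⬝ᵥ y| ≤
        eNorm (A.mulVec x - lam • x) / eNorm x ∧
      eNorm (A.mulVec x - lam • x) / eNorm x ≤
        Real.sqrt ((1 + ε) / (1 - ε)) * |b ⬝ᵥ y| := by
  have hxM : x = (fromCols U (replicateCol (Fin 1) u)).mulVec (Sum.elim y 0) := by
    rw [fromCols_mulVec]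
    simp [hx]
  have hr : A.mulVec x - lam • x = (fromCols U (replicateCol (Fin 1) u)).mulVec
      (Sum.elim 0 (fun _ => b ⬝ᵥ y)) := by
    rw [fromCols_mulVec, hx, mulVec_mulVec, hdec, add_mulVec, ← mulVec_mulVec, heig, mulVec_smul]
    ext i
    simp [vecMulVec_mulVec, mulVec, dotProduct, mul_comm]
  have e1 := hemb x ⟨_, hxM.symm⟩
  have e2 := hemb (A.mulVec x - lam • x) ⟨_, hr.symm⟩
  have n1 : eNorm (Ω.mulVec x) ^ 2 = 1 := by
    rw [hxM, sketch_norm Ω _ horth]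
    have := eNorm_sq_dot y
    rw [hy] at this
    simp [← this]
  have n2 : eNorm (Ω.mulVec (A.mulVec x - lam • x)) ^ 2 = |b ⬝ᵥ y| ^ 2 := by
    rw [hr, sketch_norm Ω _ horth, sq_abs]
    simp [sq, dotProduct]
  rw [n1] at e1
  rw [n2] at e2
  have hX0 := eNorm_nonneg' x
  have hR0 := eNorm_nonneg' (A.mulVec x - lam • x)
  generalize hR : eNorm (A.mulVec x - lam • x) = R at *
  have hXpos : 0 < eNorm x := by
    rcases hX0.lt_or_eq with h | h
    · exact h
    · rw [← h] at e1
      norm_num at e1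
  have hxne : x ≠ 0 := by
    rintro h0
    rw [h0] at hXpos
    simp [eNorm] at hXpos
  generalize eNorm x = X at *
  have hB := abs_nonneg (b ⬝ᵥ y)
  generalize |b ⬝ᵥ y| = B at *
  obtain ⟨a1, a2⟩ := e1
  obtain ⟨c1, c2⟩ := e2
  have hm : 0 < 1 - ε := by linarith
  have hp : 0 < 1 + ε := by linarith
  have hB2 : 0 ≤ B ^ 2 := sq_nonneg B
  have hX2 : 0 < X ^ 2 := by positivity
  refine ⟨hxne, ?_, ?_⟩
  · apply le_of_sq_le_sq_aux (by positivity)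
    rw [mul_pow, Real.sq_sqrt (by positivity), div_pow, div_mul_eq_mul_div,
      div_le_div_iff₀ hp hX2]
    calc (1 - ε) * B ^ 2 * X ^ 2 = ((1 - ε) * X ^ 2) * B ^ 2 := by ring
      _ ≤ 1 * B ^ 2 := by gcongr
      _ ≤ R ^ 2 * (1 + ε) := by linarith
  · apply le_of_sq_le_sq_aux (by positivity)
    rw [mul_pow, Real.sq_sqrt (by positivity), div_pow, div_mul_eq_mul_div,
      div_le_div_iff₀ hX2 hm]
    calc R ^ 2 * (1 - ε) ≤ 1 * B ^ 2 := by linarith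
      _ ≤ ((1 + ε) * X ^ 2) * B ^ 2 := by gcongr
      _ = (1 + ε) * B ^ 2 * X ^ 2 := by ring
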